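/- arXiv:2305.13218 — 2 statements merged into one kernel-verified Lean document; each statement's English description precedes it below -/
import Mathlib

section
/- Let X ∈ {0,1}^{n×k} be a k-clustering assignment matrix and Z := X(XᵀX)⁻¹Xᵀ. Then Z satisfies the triangle inequalities: for all pairwise distinct i, j, h ∈ [n], Z_{ij} + Z_{ih} ≤ Z_{ii} + Z_{jh}. (This encodes the fact that if points i and j are in the same cluster and points i and h are in the same cluster, then j and h must belong to the same cluster.) -/
open Matrix BigOperators Finset RealInnerProductSpace

/-- A `k`-clustering assignment matrix: entries in `{0,1}`, each row sums to `1`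
(each data point is assigned to exactly one cluster), and each column sum is at
least `1` (no cluster is empty). -/
def IsAssignment {n k : ℕ} (X : Matrix (Fin n) (Fin k) ℝ) : Prop :=
  (∀ i j, X i j = 0 ∨ X i j = 1) ∧
  (∀ i, ∑ j, X i j = 1) ∧
  (∀ j, 1 ≤ ∑ i, X i j)

/-- The matrix `Z = X (Xᵀ X)⁻¹ Xᵀ` associated to an assignment matrix `X`. -/
noncomputable def clusterMat {n k : ℕ} (X : Matrix (Fin n) (Fin k) ℝ) :
    Matrix (Fin n) (Fin n) ℝ :=
  X * (Xᵀ * X)⁻¹ * Xᵀ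

/-- The `j`-th cluster `C_j = {i : X i j = 1}` as a finset. -/
noncomputable def cluster {n k : ℕ} (X : Matrix (Fin n) (Fin k) ℝ) (j : Fin k) : Finset (Fin n) :=
  Finset.univ.filter (fun i => X i j = 1)

/-- The columns of an assignment matrix are pairwise orthogonal, so its Gram matrix is the
diagonal matrix of cluster sizes. -/
lemma IsAssignment.transpose_mul_self {n k : ℕ} {X : Matrix (Fin n) (Fin k) ℝ}
    (hX : IsAssignment X) : Xᵀ * X = diagonal fun c => ∑ i, X i c := by
  obtain ⟨h01, hrow, -⟩ := hX
  have hnonneg : ∀ i c, 0 ≤ X i c := fun i c => by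
    rcases h01 i c with h | h <;> simp [h]
  ext a b
  rw [mul_apply, diagonal_apply]
  split_ifs with hab
  · subst hab
    refine sum_congr rfl fun i _ => ?_
    rcases h01 i a with h | h <;> simp [h]
  · refine sum_eq_zero fun i _ => ?_
    have hle : X i a + X i b ≤ 1 := by
      rw [← hrow i, ← sum_pair hab]
      exact sum_le_sum_of_subset_of_nonneg (subset_univ _) fun c _ _ => hnonneg i c
    rcases h01 i a with ha | ha <;> rcases h01 i b with hb | hb <;> simp [ha, hb]
    norm_num [ha, hb] at hle

lemma IsAssignment.clusterMat_apply {n k : ℕ} {X : Matrix (Fin n) (Fin k) ℝ}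
    (hX : IsAssignment X) (i j : Fin n) :
    clusterMat X i j = ∑ c, (∑ l, X l c)⁻¹ * (X i c * X j c) := by
  have hinv : (Xᵀ * X)⁻¹ = diagonal fun c => (∑ l, X l c)⁻¹ := by
    rw [hX.transpose_mul_self]
    refine inv_eq_right_inv ?_
    rw [diagonal_mul_diagonal, ← diagonal_one]
    congr 1
    ext c
    exact mul_inv_cancel₀ (by linarith [hX.2.2 c])
  rw [clusterMat, hinv, mul_apply]
  refine sum_congr rfl fun c _ => ?_
  rw [mul_diagonal, transpose_apply]
  ring

/-- the triangle inequalities `Z_{ij} + Z_{ih} ≤ Z_{ii} + Z_{jh}`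
for pairwise distinct `i, j, h`. -/
theorem stmt_10 (n k : ℕ) (hk : 0 < k) (hkn : k ≤ n)
    (X : Matrix (Fin n) (Fin k) ℝ) (hX : IsAssignment X) :
    ∀ i j h : Fin n, i ≠ j → j ≠ h → i ≠ h →
      clusterMat X i j + clusterMat X i h ≤ clusterMat X i i + clusterMat X j h := by
  intro i j h _ _ _
  simp only [hX.clusterMat_apply, ← sum_add_distrib, ← mul_add]
  refine sum_le_sum fun c _ => mul_le_mul_of_nonneg_left ?_
    (inv_nonneg.2 (by linarith [hX.2.2 c]))
  rcases hX.1 i c with hi | hi <;> rcases hX.1 j c with hj | hj <;>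
    rcases hX.1 h c with hh | hh <;> norm_num [hi, hj, hh]
end

section
/- Let Z be a real symmetric n×n matrix that is entrywise nonnegative, idempotent (Z² = Z), satisfies Z·e = e for the all-ones vector e ∈ ℝⁿ, and has tr(Z) = k for a positive integer k ≤ n. Then there exists a k-clustering assignment matrix X ∈ {0,1}^{n×k} such that Z = X(XᵀX)⁻¹Xᵀ; equivalently, the relation i ~ j ⟺ Z_{ij} > 0 is an equivalence relation on [n] with exactly k classes C₁,…,C_k, and Z_{ij} = 1/|C_r| whenever i, j ∈ C_r and Z_{ij} = 0 otherwise. -/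
open Matrix BigOperators Finset RealInnerProductSpace

/-- A vector fixed by a symmetric, nonnegative, row-stochastic matrix `Z` takes equal values at
indices linked by a positive entry of `Z`. -/
theorem eq_of_mulVec_eq_self_of_pos {ι : Type*} [Fintype ι] {Z : Matrix ι ι ℝ}
    (hsym : Zᵀ = Z) (hnonneg : ∀ i j, 0 ≤ Z i j) (hrow : ∀ i, ∑ j, Z i j = 1)
    {f : ι → ℝ} (hf : Z *ᵥ f = f) {i j : ι} (hij : 0 < Z i j) : f i = f j := by
  have hs : ∀ a b, Z a b = Z b a := fun a b => (congrFun (congrFun hsym b) a :)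
  have hf' : ∀ a, ∑ b, Z a b * f b = f a := fun a => congrFun hf a
  have h1 : ∑ a, ∑ b, Z a b * f a ^ 2 = ∑ a, f a ^ 2 := by
    simp_rw [← Finset.sum_mul, hrow, one_mul]
  have h2 : ∑ a, ∑ b, Z a b * f b ^ 2 = ∑ a, f a ^ 2 := by
    rw [Finset.sum_comm, ← h1]
    simp_rw [hs]
  have energy : ∑ a, ∑ b, Z a b * (f a - f b) ^ 2 = 0 := by
    have expand : ∀ a b, Z a b * (f a - f b) ^ 2 =
        Z a b * f a ^ 2 + Z a b * f b ^ 2 - 2 * (f a * (Z a b * f b)) := fun a b => by ring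
    simp_rw [expand, Finset.sum_sub_distrib, Finset.sum_add_distrib, h1, h2, ← Finset.mul_sum,
      hf', ← pow_two]
    ring
  have hterm : ∀ a b, 0 ≤ Z a b * (f a - f b) ^ 2 :=
    fun a b => mul_nonneg (hnonneg a b) (sq_nonneg _)
  have hi := (Finset.sum_eq_zero_iff_of_nonneg
    (fun a _ => Finset.sum_nonneg fun b _ => hterm a b)).1 energy i (Finset.mem_univ i)
  have hj := (Finset.sum_eq_zero_iff_of_nonneg (fun b _ => hterm i b)).1 hi j (Finset.mem_univ j)
  exact sub_eq_zero.1 (pow_eq_zero_iff two_ne_zero |>.1 ((mul_eq_zero.1 hj).resolve_left hij.ne'))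

/-- For a symmetric, nonnegative, idempotent, row-stochastic matrix, the entry `Z i j` is positive
exactly when rows `i` and `j` coincide. -/
theorem pos_iff_row_eq {ι : Type*} [Fintype ι] {Z : Matrix ι ι ℝ}
    (hsym : Zᵀ = Z) (hnonneg : ∀ i j, 0 ≤ Z i j) (hidem : Z * Z = Z)
    (hrow : ∀ i, ∑ j, Z i j = 1) {i j : ι} : 0 < Z i j ↔ Z i = Z j := by
  have hs : ∀ a b, Z a b = Z b a := fun a b => (congrFun (congrFun hsym b) a :)
  refine ⟨fun h => funext fun c => ?_, fun h => ?_⟩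
  · refine eq_of_mulVec_eq_self_of_pos hsym hnonneg hrow (f := fun a => Z a c) ?_ h
    ext a
    exact congrFun (congrFun hidem a) c
  · rw [h]
    have hdiag : ∑ c, Z j c * Z j c = Z j j := by
      conv_rhs => rw [← hidem, Matrix.mul_apply]
      exact Finset.sum_congr rfl fun c _ => by rw [hs c j]
    refine (hnonneg j j).lt_of_ne' fun h0 => ?_
    rw [h0, Finset.sum_eq_zero_iff_of_nonneg fun c _ => mul_self_nonneg _] at hdiag
    have hzero : ∑ c, Z j c = 0 :=
      Finset.sum_eq_zero fun c hc => mul_self_eq_zero.1 (hdiag c hc)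
    rw [hrow] at hzero
    exact one_ne_zero hzero

/-- The indicator matrix of the fibres of a surjective labelling is an assignment matrix. -/
theorem isAssignment_of_surjective {n k : ℕ} {g : Fin n → Fin k} (hg : Function.Surjective g) :
    IsAssignment (Matrix.of fun i j => if g i = j then (1 : ℝ) else 0) := by
  refine ⟨fun i j => ?_, fun i => by simp, fun j => ?_⟩
  · by_cases h : g i = j <;> simp [h]
  · obtain ⟨i, rfl⟩ := hg j
    have := Finset.single_le_sum (f := fun a => if g a = g i then (1 : ℝ) else 0)
      (fun a _ => by positivity) (Finset.mem_univ i)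
    simpa using this

/-- Entries of `X (Xᵀ X)⁻¹ Xᵀ` for the indicator matrix `X` of a surjective labelling. -/
theorem clusterMat_apply_of_surjective {n k : ℕ} {g : Fin n → Fin k}
    (hg : Function.Surjective g) (i j : Fin n) :
    clusterMat (Matrix.of fun i j => if g i = j then (1 : ℝ) else 0) i j =
      if g i = g j then ((#{a | g a = g i} : ℕ) : ℝ)⁻¹ else 0 := by
  set X : Matrix (Fin n) (Fin k) ℝ := Matrix.of fun i j => if g i = j then (1 : ℝ) else 0 with hX
  set d : Fin k → ℝ := fun c => (#{a | g a = c} : ℕ) with hd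
  have hgram : Xᵀ * X = diagonal d := by
    ext c c'
    by_cases h : c = c'
    · subst h
      simp [hX, hd, Matrix.mul_apply, ← ite_and]
    · simp only [Matrix.mul_apply, Matrix.transpose_apply, diagonal_apply_ne _ h]
      refine Finset.sum_eq_zero fun a _ => ?_
      by_cases ha : g a = c
      · simp [hX, ha, h]
      · simp [hX, ha]
  have hd0 : ∀ c, d c ≠ 0 := fun c => by
    obtain ⟨a, rfl⟩ := hg c
    exact Nat.cast_ne_zero.2 (Finset.card_ne_zero_of_mem (a := a) (by simp))
  have hinv : (Xᵀ * X)⁻¹ = diagonal d⁻¹ := by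
    rw [hgram]
    refine Matrix.inv_eq_right_inv ?_
    rw [diagonal_mul_diagonal, ← diagonal_one]
    exact congrArg diagonal (funext fun c => mul_inv_cancel₀ (hd0 c))
  rw [clusterMat, hinv, Matrix.mul_apply]
  by_cases h : g i = g j
  · simp [hX, hd, Matrix.mul_diagonal, h]
  · simp [hX, hd, Matrix.mul_diagonal, h]

/-- converse of the Peng–Wei lifting. If `Z` is symmetric, entrywise
nonnegative, idempotent, satisfies `Z e = e`, and `tr(Z) = k`, then `Z` comes from
a `k`-clustering assignment matrix `X` via `Z = X (Xᵀ X)⁻¹ Xᵀ`. -/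
theorem stmt_17 (n k : ℕ) (hk : 0 < k) (hkn : k ≤ n)
    (Z : Matrix (Fin n) (Fin n) ℝ)
    (hsym : Zᵀ = Z)
    (hnonneg : ∀ i j : Fin n, 0 ≤ Z i j)
    (hidem : Z * Z = Z)
    (hones : Z *ᵥ (fun _ => (1 : ℝ)) = fun _ => (1 : ℝ))
    (htr : Z.trace = (k : ℝ)) :
    ∃ X : Matrix (Fin n) (Fin k) ℝ, IsAssignment X ∧ Z = X * (Xᵀ * X)⁻¹ * Xᵀ := by
  have hrow : ∀ i, ∑ j, Z i j = 1 := fun i => by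
    simpa [Matrix.mulVec, dotProduct] using congrFun hones i
  have hpos : ∀ {i j}, 0 < Z i j ↔ Z i = Z j := pos_iff_row_eq hsym hnonneg hidem hrow
  have hs : ∀ a b, Z a b = Z b a := fun a b => (congrFun (congrFun hsym b) a :)
  have hzero : ∀ {i j}, Z i ≠ Z j → Z i j = 0 := fun h =>
    le_antisymm (not_lt.1 (mt hpos.1 h)) (hnonneg _ _)
  have hdiag : ∀ {i j}, Z i = Z j → Z i j = Z i i := fun {i j} h => by
    rw [hs i j, ← h]
  classical
  have hclass : ∀ i, ∑ a with Z a = Z i, Z i a = 1 := fun i => by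
    rw [← hrow i, Finset.sum_filter_of_ne]
    intro a _ ha
    by_contra h
    exact ha (hzero (Ne.symm h))
  have hcard : #(univ.image Z.row) = k := by
    have key : Z.trace = (#(univ.image Z.row) : ℕ) := by
      rw [Matrix.trace, ← Finset.sum_fiberwise_of_maps_to
        (fun i _ => Finset.mem_image_of_mem Z.row (Finset.mem_univ i)),
        Finset.card_eq_sum_ones, Nat.cast_sum]
      refine Finset.sum_congr rfl fun s hs' => ?_
      obtain ⟨i, -, rfl⟩ := Finset.mem_image.1 hs'
      rw [Nat.cast_one, ← hclass i]
      refine Finset.sum_congr (Finset.filter_congr fun _ _ => Iff.rfl) fun a ha => ?_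
      exact congrFun (Finset.mem_filter.1 ha).2 a
    exact_mod_cast key.symm.trans htr
  let e := Finset.equivFinOfCardEq hcard
  let g : Fin n → Fin k := fun i => e ⟨Z.row i, Finset.mem_image_of_mem Z.row (Finset.mem_univ i)⟩
  have hgZ : ∀ i j, g i = g j ↔ Z i = Z j := fun i j => by
    simp only [g, e.injective.eq_iff, Subtype.mk.injEq]
    rfl
  have hg : Function.Surjective g := fun c => by
    obtain ⟨i, -, hi⟩ := Finset.mem_image.1 (e.symm c).2
    exact ⟨i, e.symm_apply_eq.1 (Subtype.ext hi.symm) |>.symm⟩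
  refine ⟨_, isAssignment_of_surjective hg, ?_⟩
  ext i j
  refine Eq.trans ?_ (clusterMat_apply_of_surjective hg i j).symm
  simp_rw [hgZ]
  split_ifs with h
  · rw [hdiag h]
    refine eq_inv_of_mul_eq_one_right ?_
    rw [← hclass i, ← nsmul_eq_mul, ← Finset.sum_const]
    exact Finset.sum_congr rfl fun a ha => (hdiag (Finset.mem_filter.1 ha).2.symm).symm
  · exact hzero h
end
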